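/- arXiv:1409.8147 — 2 statements merged into one kernel-verified Lean document; each statement's English description precedes it below -/
import Mathlib

section
/- Continuity of the iteration mapping. Under the inner convex constraints assumptions on D(·) and the upper local model assumptions on h, and assuming inf{f(x) : x ∈ D} > −∞, the iteration mapping p : D → ℝⁿ, p(x) = argmin{h(x,y) : y ∈ D(x)}, is continuous on D. -/
open Filter Topology

noncomputable section

/-- Quadratic growth of a strongly convex function away from its minimizer on a convex set. -/
theorem StrongConvexOn.quadratic_growth {E : Type*} [NormedAddCommGroup E] [NormedSpace ℝ E]
    {s C : Set E} {μ : ℝ} {g : E → ℝ} (hg : StrongConvexOn s μ g) (hCs : C ⊆ s)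
    (hC : Convex ℝ C) {x y : E} (hx : x ∈ C) (hy : y ∈ C) (hmin : IsMinOn g C x) :
    μ / 4 * ‖x - y‖ ^ 2 ≤ g y - g x := by
  have hconv := hg.2 (hCs hx) (hCs hy) (by norm_num : (0 : ℝ) ≤ 1 / 2)
    (by norm_num : (0 : ℝ) ≤ 1 / 2) (by norm_num)
  have hmid := isMinOn_iff.1 hmin _ (hC hx hy (by norm_num : (0 : ℝ) ≤ 1 / 2)
    (by norm_num : (0 : ℝ) ≤ 1 / 2) (by norm_num))
  simp only [smul_eq_mul] at hconv
  linarith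

/-- **Continuity of the iteration mapping.**
Under the inner convex constraints assumptions on `D(·)` and the upper local
model assumptions on `h`, and assuming `inf {f(x) : x ∈ D} > −∞`, the iteration
mapping `p(x) = argmin{h(x,y) : y ∈ D(x)}` is continuous on `D`. -/
theorem iteration_mapping_continuous
    {n : ℕ}
    (f : EuclideanSpace ℝ (Fin n) → ℝ)
    (D : Set (EuclideanSpace ℝ (Fin n)))
    (Dm : EuclideanSpace ℝ (Fin n) → Set (EuclideanSpace ℝ (Fin n)))
    (h : EuclideanSpace ℝ (Fin n) → EuclideanSpace ℝ (Fin n) → ℝ)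
    (μ : ℝ) (hμ : 0 < μ)
    (hfLip : LocallyLipschitz f)
    (hbdd : BddBelow (f '' D))
    (hDne : D.Nonempty) (hDclosed : IsClosed D)
    -- inner convex constraints assumptions
    (hDmne : ∀ z ∈ D, (Dm z).Nonempty)
    (hDmsub : ∀ z ∈ D, Dm z ⊆ D)
    (hDmclosed : ∀ z, IsClosed (Dm z)) (hDmconv : ∀ z, Convex ℝ (Dm z))
    -- outer semicontinuity of `D(·)` on `D`
    (houter : ∀ z ∈ D, ∀ (xj yj : ℕ → EuclideanSpace ℝ (Fin n))
        (y : EuclideanSpace ℝ (Fin n)),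
      Tendsto xj atTop (𝓝 z) → (∀ j, yj j ∈ Dm (xj j)) → Tendsto yj atTop (𝓝 y) →
      y ∈ Dm z)
    -- inner semicontinuity of `D(·)` on `D`
    (hinner : ∀ z ∈ D, ∀ xj : ℕ → EuclideanSpace ℝ (Fin n),
      Tendsto xj atTop (𝓝 z) → ∀ y ∈ Dm z,
      ∃ (yj : ℕ → EuclideanSpace ℝ (Fin n)) (N : ℕ),
        (∀ j, N ≤ j → yj j ∈ Dm (xj j)) ∧ Tendsto yj atTop (𝓝 y))
    -- upper local model assumptions
    (hhcont : Continuous fun p : EuclideanSpace ℝ (Fin n) × EuclideanSpace ℝ (Fin n) =>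
      h p.1 p.2)
    (hconsist : ∀ z ∈ D, h z z = f z)
    (hupper : ∀ z ∈ D, ∀ y ∈ Dm z, f y ≤ h z y)
    (hsc : ∀ z ∈ D, StrongConvexOn Set.univ μ (h z))
    -- the iteration mapping
    (p : EuclideanSpace ℝ (Fin n) → EuclideanSpace ℝ (Fin n))
    (hp : ∀ z ∈ D, p z ∈ Dm z ∧ ∀ y ∈ Dm z, h z (p z) ≤ h z y) :
    ContinuousOn p D := by
  have growth : ∀ z ∈ D, ∀ y ∈ Dm z, μ / 4 * ‖p z - y‖ ^ 2 ≤ h z y - h z (p z) :=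
    fun z hz y hy ↦ (hsc z hz).quadratic_growth (Set.subset_univ _) (hDmconv z) (hp z hz).1 hy
      (isMinOn_iff.2 (hp z hz).2)
  obtain ⟨c, hc⟩ := hbdd
  have lower : ∀ z ∈ D, c ≤ h z (p z) := fun z hz ↦
    (hc ⟨p z, hDmsub z hz (hp z hz).1, rfl⟩).trans (hupper z hz _ (hp z hz).1)
  rw [continuousOn_iff_continuous_domRestrict, continuous_iff_seqContinuous]
  intro u z hu
  refine tendsto_of_subseq_tendsto fun ns hns ↦ ?_
  set x : ℕ → EuclideanSpace ℝ (Fin n) := fun j ↦ u (ns j)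
  have hxD : ∀ j, x j ∈ D := fun j ↦ (u (ns j)).2
  have hx : Tendsto x atTop (𝓝 z) := (continuous_subtype_val.tendsto z).comp (hu.comp hns)
  obtain ⟨y, N, hyD, hy⟩ := hinner z z.2 x hx (p z) (hp z z.2).1
  have hval : Tendsto (fun j ↦ h (x j) (y j)) atTop (𝓝 (h z (p z))) :=
    (hhcont.tendsto ((z : EuclideanSpace ℝ (Fin n)), p z)).comp (hx.prodMk_nhds hy)
  set R : ℝ := √(4 / μ * (h z (p z) + 1 - c))
  have hbound : ∀ᶠ j in atTop, p (x j) ∈ Metric.closedBall (p z) (R + 1) := by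
    filter_upwards [eventually_ge_atTop N, hval.eventually (gt_mem_nhds (lt_add_one _)),
      hy.eventually (Metric.closedBall_mem_nhds _ one_pos)] with j hj hlt hclose
    have hgrow := growth _ (hxD j) _ (hyD j hj)
    have hlow := lower _ (hxD j)
    have hdist : dist (p (x j)) (y j) ≤ R := by
      rw [dist_eq_norm]
      apply Real.le_sqrt_of_sq_le
      calc ‖p (x j) - y j‖ ^ 2 = 4 / μ * (μ / 4 * ‖p (x j) - y j‖ ^ 2) := by field_simp
        _ ≤ 4 / μ * (h z (p z) + 1 - c) := by gcongr; linarith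
    exact (dist_triangle _ (y j) _).trans (add_le_add hdist hclose)
  obtain ⟨q, -, φ, hφ, hq⟩ :=
    tendsto_subseq_of_frequently_bounded Metric.isBounded_closedBall hbound.frequently
  have hxφ := hx.comp hφ.tendsto_atTop
  have hqD : q ∈ Dm z := houter z z.2 _ _ q hxφ (fun j ↦ (hp _ (hxD (φ j))).1) hq
  have hqle : h z q ≤ h z (p z) :=
    le_of_tendsto_of_tendsto ((hhcont.tendsto ((z : EuclideanSpace ℝ (Fin n)), q)).comp
      (hxφ.prodMk_nhds hq)) (hval.comp hφ.tendsto_atTop) <| by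
        filter_upwards [hφ.tendsto_atTop.eventually_ge_atTop N] with j hj
        exact (hp _ (hxD (φ j))).2 _ (hyD _ hj)
  have hqeq : p z = q := by
    have hgrow := growth z z.2 q hqD
    have hsq : ‖p z - q‖ ^ 2 ≤ 0 :=
      nonpos_of_mul_nonpos_right (by linarith) (by positivity : 0 < μ / 4)
    simpa [sub_eq_zero] using le_antisymm hsq (sq_nonneg _)
  exact ⟨φ, by rw [Set.domRestrict_apply, hqeq]; exact hq⟩
end
end

section
/- Connectedness of the feasible set under the qualification condition. Assume Q = ℝⁿ, the functions f_1,…,f_m : ℝⁿ → ℝ are C² with Lipschitz continuous gradients, the set {x : f_i(x) ≤ μ_i, i = 1,…,m} is compact for all real numbers μ_1,…,μ_m, and the function g = max{f_i : i = 1,…,m} has no (Clarke) critical point on the set {x : ∃i, f_i(x) ≥ 0}. Then the feasible set F = {x : f_i(x) ≤ 0, i = 1,…,m} is connected. -/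
open Filter Topology

noncomputable section

section Descent

lemma le_iSup_of_finite {E ι : Type*} [Finite ι] {f : ι → E → ℝ} (x : E) (i : ι) :
    f i x ≤ ⨆ j, f j x :=
  le_ciSup (f := fun j => f j x) (Set.finite_range _).bddAbove i

variable {E ι : Type*} [NormedAddCommGroup E] [NormedSpace ℝ E]

/-- If `f` is strictly differentiable at `x` and `V x` is a descent direction, then moving along `V`
decreases `f` at a linear rate, uniformly near `x`. -/
lemma HasStrictFDerivAt.exists_eventually_le_sub {f : E → ℝ} {f' : E →L[ℝ] ℝ} {x : E}
    (hf : HasStrictFDerivAt f f' x) {V : E → E} (hV : ContinuousAt V x) (hneg : f' (V x) < 0) :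
    ∃ η > 0, ∀ᶠ p : E × ℝ in 𝓝 x ×ˢ 𝓝[>] 0, f (p.1 + p.2 • V p.1) ≤ f p.1 - p.2 * η := by
  obtain ⟨d, hd⟩ : ∃ d, d = -f' (V x) := ⟨_, rfl⟩
  have hd0 : 0 < d := by linarith
  have hN : 0 < ‖V x‖ + 1 := by positivity
  refine ⟨d / 4, by positivity, ?_⟩
  have hfst : Tendsto (fun p : E × ℝ => p.1) (𝓝 x ×ˢ 𝓝[>] 0) (𝓝 x) := tendsto_fst
  have hsnd : Tendsto (fun p : E × ℝ => p.2) (𝓝 x ×ˢ 𝓝[>] 0) (𝓝[>] 0) := tendsto_snd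
  have hVt : Tendsto (fun p : E × ℝ => V p.1) (𝓝 x ×ˢ 𝓝[>] 0) (𝓝 (V x)) := hV.tendsto.comp hfst
  have hmove : Tendsto (fun p : E × ℝ => (p.1 + p.2 • V p.1, p.1)) (𝓝 x ×ˢ 𝓝[>] 0)
      (𝓝 (x, x)) := by
    have h := hfst.add ((tendsto_nhds_of_tendsto_nhdsWithin hsnd).smul hVt)
    rw [zero_smul, add_zero] at h
    exact h.prodMk_nhds hfst
  have hlit := hmove.eventually (hf.isLittleO.def (show 0 < d / (4 * (‖V x‖ + 1)) by positivity))
  have hder := ((f'.continuous.tendsto _).comp hVt).eventually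
    (gt_mem_nhds (show f' (V x) < -(d / 2) by linarith))
  have hnorm := hVt.norm.eventually (gt_mem_nhds (lt_add_one ‖V x‖))
  filter_upwards [hlit, hder, hnorm, hsnd.eventually self_mem_nhdsWithin] with p h₁ h₂ h₃ hs
  have hs : 0 < p.2 := hs
  simp only [add_sub_cancel_left, map_smul, smul_eq_mul, norm_smul, Real.norm_eq_abs,
    _root_.abs_of_pos hs, Function.comp_apply] at h₁ h₂
  have h₄ : d / (4 * (‖V x‖ + 1)) * (p.2 * ‖V p.1‖) ≤ p.2 * (d / 4) := by
    calc d / (4 * (‖V x‖ + 1)) * (p.2 * ‖V p.1‖)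
        ≤ d / (4 * (‖V x‖ + 1)) * (p.2 * (‖V x‖ + 1)) := by gcongr
      _ = p.2 * (d / 4) := by field_simp
  have h₅ := (le_abs_self _).trans (h₁.trans h₄)
  have h₆ : p.2 * f' (V p.1) ≤ p.2 * -(d / 2) := by gcongr
  linarith

variable [Finite ι] [Nonempty ι] {f : ι → E → ℝ}

/-- If `V x` is a common descent direction of all functions active at `x` (as soon as the maximum is
nonnegative), then moving along `V` decreases the positive part of the maximum at a linear rate,
uniformly near `x`. -/
lemma exists_eventually_iSup_le (hf : ∀ i, ContDiff ℝ 1 (f i)) {V : E → E} {x : E}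
    (hV : ContinuousAt V x)
    (hneg : ∀ j, f j x = ⨆ i, f i x → 0 ≤ f j x → fderiv ℝ (f j) x (V x) < 0) :
    ∃ η > 0, ∀ᶠ p : E × ℝ in 𝓝 x ×ˢ 𝓝[>] 0,
      ⨆ i, f i (p.1 + p.2 • V p.1) ≤ max 0 ((⨆ i, f i p.1) - p.2 * η) := by
  obtain ⟨k, hk⟩ := exists_eq_ciSup_of_finite (f := fun i => f i x)
  have hfst : Tendsto (fun p : E × ℝ => p.1) (𝓝 x ×ˢ 𝓝[>] 0) (𝓝 x) := tendsto_fst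
  have hsnd : Tendsto (fun p : E × ℝ => p.2) (𝓝 x ×ˢ 𝓝[>] 0) (𝓝[>] 0) := tendsto_snd
  have hsnd₀ := tendsto_nhds_of_tendsto_nhdsWithin hsnd
  have hmove : Tendsto (fun p : E × ℝ => p.1 + p.2 • V p.1) (𝓝 x ×ˢ 𝓝[>] 0) (𝓝 x) := by
    have h := hfst.add (hsnd₀.smul (hV.tendsto.comp hfst))
    rwa [zero_smul, add_zero] at h
  have key : ∀ j, ∃ η > 0, ∀ᶠ p : E × ℝ in 𝓝 x ×ˢ 𝓝[>] 0,
      f j (p.1 + p.2 • V p.1) ≤ max 0 ((⨆ i, f i p.1) - p.2 * η) := by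
    intro j
    by_cases hj : f j x = ⨆ i, f i x ∧ 0 ≤ f j x
    · obtain ⟨η, hη, h⟩ := ((hf j).contDiffAt.hasStrictFDerivAt one_ne_zero).exists_eventually_le_sub
        hV (hneg j hj.1 hj.2)
      refine ⟨η, hη, h.mono fun p hp => hp.trans (le_max_of_le_right ?_)⟩
      gcongr
      exact le_iSup_of_finite _ j
    · have hlt : f j x < max 0 (f k x - 0 * 1) := by
        have := le_iSup_of_finite (f := f) x j
        rw [zero_mul, sub_zero, hk, lt_max_iff]
        by_contra! hcon
        exact hj ⟨this.antisymm hcon.2, hcon.1⟩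
      refine ⟨1, one_pos, ?_⟩
      have hl := ((hf j).continuous.tendsto x).comp hmove
      have hr := (tendsto_const_nhds (x := (0 : ℝ))).max
        ((((hf k).continuous.tendsto x).comp hfst).sub (hsnd₀.mul_const 1))
      filter_upwards [hl.eventually_lt hr hlt] with p hp
      refine hp.le.trans (max_le_max le_rfl ?_)
      exact sub_le_sub_right (le_iSup_of_finite (f := f) p.1 k) _
  choose η hη h using key
  obtain ⟨i₀, hi₀⟩ := Finite.exists_min η
  refine ⟨η i₀, hη i₀, ?_⟩
  filter_upwards [eventually_all.2 h, hsnd.eventually self_mem_nhdsWithin] with p hp hs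
  refine ciSup_le fun i => (hp i).trans (max_le_max le_rfl ?_)
  have : p.2 * η i₀ ≤ p.2 * η i := mul_le_mul_of_nonneg_left (hi₀ i) (le_of_lt hs)
  linarith

/-- A compact set admits a uniform step size and a uniform rate for the descent along `V`. -/
lemma IsCompact.exists_uniform_descent (hf : ∀ i, ContDiff ℝ 1 (f i)) {V : E → E}
    (hV : Continuous V)
    (hneg : ∀ x j, f j x = ⨆ i, f i x → 0 ≤ f j x → fderiv ℝ (f j) x (V x) < 0)
    {K : Set E} (hK : IsCompact K) :
    ∃ η > 0, ∃ τ > 0, ∀ s ∈ Set.Ioc 0 τ, ∀ x ∈ K,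
      ⨆ i, f i (x + s • V x) ≤ max 0 ((⨆ i, f i x) - s * η) := by
  have key : ∃ η > 0, ∀ᶠ s in 𝓝[>] (0 : ℝ), ∀ x ∈ K,
      ⨆ i, f i (x + s • V x) ≤ max 0 ((⨆ i, f i x) - s * η) := by
    refine hK.induction_on ⟨1, one_pos, by simp⟩ ?_ ?_ ?_
    · rintro s t hst ⟨η, hη, h⟩
      exact ⟨η, hη, h.mono fun r hr x hx => hr x (hst hx)⟩
    · rintro s t ⟨η₁, hη₁, h₁⟩ ⟨η₂, hη₂, h₂⟩
      refine ⟨min η₁ η₂, lt_min hη₁ hη₂, ?_⟩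
      filter_upwards [h₁, h₂, self_mem_nhdsWithin] with r hr₁ hr₂ hr
      have hr : 0 < r := hr
      rintro x (hx | hx)
      · refine (hr₁ x hx).trans (max_le_max le_rfl ?_)
        gcongr
        exact min_le_left _ _
      · refine (hr₂ x hx).trans (max_le_max le_rfl ?_)
        gcongr
        exact min_le_right _ _
    · intro x _
      obtain ⟨η, hη, h⟩ := exists_eventually_iSup_le hf hV.continuousAt (hneg x)
      obtain ⟨p, hp, q, hq, hpq⟩ := eventually_prod_iff.1 h
      exact ⟨{y | p y}, mem_nhdsWithin_of_mem_nhds hp, η, hη, hq.mono fun s hs y hy => hpq hy hs⟩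
  obtain ⟨η, hη, h⟩ := key
  obtain ⟨τ, hτ, h⟩ := mem_nhdsGT_iff_exists_Ioc_subset.1 h
  exact ⟨η, hη, τ, hτ, fun s hs => h hs⟩

/-- Compact sublevel sets of a maximum of `C¹` functions that decreases along `V` where it is
nonnegative can be mapped continuously into `{x | ⨆ i, f i x ≤ 0}`, joining each point of the latter
set to its image. -/
lemma exists_continuous_iSup_nonpos (hf : ∀ i, ContDiff ℝ 1 (f i)) {V : E → E}
    (hV : Continuous V)
    (hneg : ∀ x j, f j x = ⨆ i, f i x → 0 ≤ f j x → fderiv ℝ (f j) x (V x) < 0)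
    {c : ℝ} (hc : 0 ≤ c) (hK : IsCompact {x | ⨆ i, f i x ≤ c}) :
    ∃ φ : E → E, Continuous φ ∧ (∀ x, ⨆ i, f i x ≤ c → ⨆ i, f i (φ x) ≤ 0) ∧
      ∀ x, ⨆ i, f i x ≤ 0 → JoinedIn {x | ⨆ i, f i x ≤ 0} x (φ x) := by
  obtain ⟨η, hη, τ, hτ, h⟩ := hK.exists_uniform_descent hf hV hneg
  obtain ⟨N, hN⟩ := exists_nat_gt (c / (τ * η))
  rw [div_lt_iff₀ (by positivity)] at hN
  obtain ⟨φ, hφ⟩ : ∃ φ : E → E, φ = fun x => x + τ • V x := ⟨_, rfl⟩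
  have hφc : Continuous φ := by rw [hφ]; fun_prop
  have hstep : ∀ x, ⨆ i, f i x ≤ c → ⨆ i, f i (φ x) ≤ max 0 ((⨆ i, f i x) - τ * η) := by
    intro x hx
    rw [hφ]
    exact h τ ⟨hτ, le_rfl⟩ x hx
  have hjoin : ∀ x, ⨆ i, f i x ≤ 0 → JoinedIn {x | ⨆ i, f i x ≤ 0} x (φ x) := by
    intro x hx
    refine JoinedIn.of_segment_subset ?_
    rw [segment_eq_image', hφ]
    rintro _ ⟨θ, ⟨hθ₀, hθ₁⟩, rfl⟩
    simp only [add_sub_cancel_left, smul_smul, Set.mem_ofPred_eq]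
    rcases hθ₀.eq_or_lt with rfl | hθ
    · simpa using hx
    · refine (h (θ * τ) ⟨by positivity, by nlinarith⟩ x (hx.trans hc)).trans (max_le le_rfl ?_)
      have : 0 < θ * τ * η := by positivity
      linarith
  refine ⟨φ^[N], hφc.iterate N, fun x hx => ?_, fun x hx => ?_⟩
  · have hit : ∀ k : ℕ, ⨆ i, f i (φ^[k] x) ≤ max 0 (c - k * (τ * η)) := by
      intro k
      induction k with
      | zero => simp [hx]
      | succ k ih =>
        have hpos : 0 < τ * η := by positivity
        rw [Function.iterate_succ_apply']
        refine (hstep _ (ih.trans (max_le hc ?_))).trans (max_le (le_max_left _ _) ?_)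
        · have : 0 ≤ (k : ℝ) * (τ * η) := by positivity
          linarith
        · push_cast
          rcases le_max_iff.1 ih with ih | ih
          · exact le_max_of_le_left (by linarith)
          · exact le_max_of_le_right (by linarith)
    exact (hit N).trans (max_le le_rfl (by linarith))
  · generalize N = k
    induction k with
    | zero => exact JoinedIn.refl hx
    | succ k ih =>
      rw [Function.iterate_succ_apply']
      exact ih.trans (hjoin _ ih.target_mem)

/-- If all sublevel sets of a maximum of `C¹` functions are compact, and it decreases along a
continuous field `V` where it is nonnegative, then `{x | ⨆ i, f i x ≤ 0}` is path connected. -/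
lemma isPathConnected_iSup_nonpos (hf : ∀ i, ContDiff ℝ 1 (f i)) {V : E → E}
    (hV : Continuous V)
    (hneg : ∀ x j, f j x = ⨆ i, f i x → 0 ≤ f j x → fderiv ℝ (f j) x (V x) < 0)
    (hK : ∀ c : ℝ, IsCompact {x | ⨆ i, f i x ≤ c}) :
    IsPathConnected {x | ⨆ i, f i x ≤ 0} := by
  rw [isPathConnected_iff]
  constructor
  · obtain ⟨φ, -, hφ, -⟩ := exists_continuous_iSup_nonpos hf hV hneg
      (le_max_left 0 (⨆ i, f i 0)) (hK _)
    exact ⟨φ 0, hφ 0 (le_max_right _ _)⟩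
  · intro a ha b hb
    have hcomp : IsCompact (segment ℝ a b) := by
      rw [segment_eq_image_lineMap]
      exact isCompact_Icc.image AffineMap.lineMap_continuous
    choose C hC using fun i => hcomp.bddAbove_image (hf i).continuous.continuousOn
    obtain ⟨φ, hφc, hφ, hjoin⟩ := exists_continuous_iSup_nonpos hf hV hneg
      (le_max_left 0 (⨆ i, C i)) (hK _)
    refine (hjoin a ha).trans (JoinedIn.trans ?_ (hjoin b hb).symm)
    refine ((JoinedIn.of_segment_subset subset_rfl).map hφc).mono ?_
    rintro _ ⟨x, hx, rfl⟩
    refine hφ x (le_max_of_le_right (ciSup_le fun i => ?_))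
    exact (hC i ⟨x, hx, rfl⟩).trans (le_ciSup (Set.finite_range _).bddAbove i)

end Descent

section CriticalPoints

variable {E ι : Type*} [NormedAddCommGroup E] [InnerProductSpace ℝ E] [CompleteSpace E]

/-- If `0` is not in the convex hull of finitely many gradients, then they have a common descent
direction. -/
lemma exists_fderiv_neg_of_zero_notMem_convexHull {f : ι → E → ℝ} {x : E} {s : Set ι}
    (hs : s.Finite) (h : (0 : E) ∉ convexHull ℝ ((fun j => gradient (f j) x) '' s)) :
    ∃ v, ∀ j ∈ s, fderiv ℝ (f j) x v < 0 := by
  obtain ⟨l, u, hu, hl⟩ := geometric_hahn_banach_point_closed (convex_convexHull ℝ _)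
    ((hs.image _).isClosed_convexHull ℝ) h
  rw [map_zero] at hu
  refine ⟨-(InnerProductSpace.toDual ℝ E).symm l, fun j hj => ?_⟩
  have := hl _ (subset_convexHull ℝ _ ⟨j, hj, rfl⟩)
  rw [← inner_gradient_left, inner_neg_right, real_inner_comm,
    InnerProductSpace.toDual_symm_apply]
  linarith

/-- A maximum of `C¹` functions without nonnegative Clarke critical values admits a continuous field
of descent directions on the set where it is nonnegative. -/
lemma exists_continuous_descent_field [Finite ι] [Nonempty ι] {f : ι → E → ℝ}
    (hf : ∀ i, ContDiff ℝ 1 (f i))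
    (hcrit : ∀ x, (∃ i, 0 ≤ f i x) →
      (0 : E) ∉ convexHull ℝ ((fun j => gradient (f j) x) '' {j | f j x = ⨆ i, f i x})) :
    ∃ V : E → E, Continuous V ∧
      ∀ x j, f j x = ⨆ i, f i x → 0 ≤ f j x → fderiv ℝ (f j) x (V x) < 0 := by
  suffices ∃ V : C(E, E), ∀ x,
      V x ∈ {v | ∀ j, f j x = ⨆ i, f i x → 0 ≤ f j x → fderiv ℝ (f j) x v < 0} from
    this.elim fun V hV => ⟨V, V.continuous, hV⟩
  refine exists_continuous_forall_mem_convex_of_local_const (fun x => ?_) (fun x => ?_)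
  · intro v hv w hw a b ha hb hab j hj hj₀
    have h₁ := hv j hj hj₀
    have h₂ := hw j hj hj₀
    rw [map_add, map_smul, map_smul]
    exact convex_Iio (0 : ℝ) h₁ h₂ ha hb hab
  · obtain ⟨v, hv⟩ : ∃ v, ∀ j, f j x = ⨆ i, f i x → 0 ≤ f j x → fderiv ℝ (f j) x v < 0 := by
      by_cases hx : ∃ i, 0 ≤ f i x
      · obtain ⟨v, hv⟩ := exists_fderiv_neg_of_zero_notMem_convexHull (Set.toFinite _) (hcrit x hx)
        exact ⟨v, fun j hj _ => hv j hj⟩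
      · exact ⟨0, fun j _ hj₀ => absurd ⟨j, hj₀⟩ hx⟩
    refine ⟨v, eventually_all.2 fun j => ?_⟩
    by_cases hj : f j x = ⨆ i, f i x ∧ 0 ≤ f j x
    · have hcont : Continuous fun y => fderiv ℝ (f j) y v :=
        ((hf j).continuous_fderiv one_ne_zero).clm_apply continuous_const
      filter_upwards [hcont.continuousAt.eventually (gt_mem_nhds (hv j hj.1 hj.2))] with y hy _ _
      exact hy
    · obtain ⟨k, hk⟩ := exists_eq_ciSup_of_finite (f := fun i => f i x)
      have hlt : f j x < max 0 (f k x) := by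
        rw [hk, lt_max_iff]
        by_contra! hcon
        exact hj ⟨(le_iSup_of_finite x j).antisymm hcon.2, hcon.1⟩
      have hev := ((hf j).continuous.tendsto x).eventually_lt
        ((tendsto_const_nhds (x := (0 : ℝ))).max ((hf k).continuous.tendsto x)) hlt
      filter_upwards [hev] with y hy hj' hj₀
      exact absurd hy (max_le hj₀ (hj' ▸ le_iSup_of_finite y k)).not_gt

end CriticalPoints

/-- **Connectedness of the feasible set under the qualification condition.**
If `Q = ℝⁿ`, the `f_i` are `C²` with Lipschitz continuous gradients, the sets
`{x : f_i(x) ≤ μ_i ∀i}` are compact, and `g = max_i f_i` has no Clarke critical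
point on `{x : ∃ i, f_i(x) ≥ 0}`, then the feasible set
`F = {x : f_i(x) ≤ 0 ∀i}` is connected. -/
theorem feasible_set_connected
    {n m : ℕ}
    (fc : Fin m → EuclideanSpace ℝ (Fin n) → ℝ)
    (Lc : Fin m → ℝ)
    (hfc2 : ∀ i, ContDiff ℝ 2 (fc i))
    (hLc : ∀ i, 0 < Lc i)
    (hLipc : ∀ i, ∀ a b, ‖gradient (fc i) a - gradient (fc i) b‖ ≤ Lc i * ‖a - b‖)
    -- compactness of all sublevel sets
    (hcompact : ∀ μ : Fin m → ℝ, IsCompact {x | ∀ i, fc i x ≤ μ i})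
    -- no Clarke critical point of `g = max_i f_i` on `{x : ∃ i, f_i(x) ≥ 0}`:
    -- `0` is not in the convex hull of the gradients of the active functions
    (hcrit : ∀ x : EuclideanSpace ℝ (Fin n), (∃ i, 0 ≤ fc i x) →
      (0 : EuclideanSpace ℝ (Fin n)) ∉
        convexHull ℝ ((fun j => gradient (fc j) x) ''
          {j : Fin m | fc j x = ⨆ i, fc i x})) :
    IsConnected {x : EuclideanSpace ℝ (Fin n) | ∀ i, fc i x ≤ 0} := by
  rcases isEmpty_or_nonempty (Fin m) with hm | hm
  · simpa using isConnected_univ (α := EuclideanSpace ℝ (Fin n))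
  have hf : ∀ i, ContDiff ℝ 1 (fc i) := fun i => (hfc2 i).of_le one_le_two
  have hset : ∀ c : ℝ, {x | ⨆ i, fc i x ≤ c} = {x | ∀ i, fc i x ≤ c} := by
    intro c
    ext x
    exact ciSup_le_iff (f := fun i => fc i x) (Set.finite_range _).bddAbove
  obtain ⟨V, hV, hneg⟩ := exists_continuous_descent_field hf hcrit
  have h := isPathConnected_iSup_nonpos hf hV hneg fun c => hset c ▸ hcompact fun _ => c
  rw [hset] at h
  exact h.isConnected
end
end
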